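/- Let (Γ,γ) be a connected 5-colored graph representing a singular 4-manifold, ε a cyclic permutation of Δ₄, and write ρ = ρ_ε(Γ), ρ_î = ρ_ε(Γ_{ε̂_i}). Then for each i ∈ Δ₄: ρ_{î-1} + ρ_{î+1} ≤ ρ (subscripts mod 5 in the cyclic order of ε). Consequently Σ_{i∈Δ₄} ρ_î ≤ ⌊(5/2)ρ⌋, with equality Σ_i ρ_î = (5/2)ρ if and only if ρ_{î-1} + ρ_{î+1} = ρ for all i ∈ Δ₄. -/

import Mathlib

open scoped Classical

namespace Cryst

/-- A `(d+1)`-regular properly edge-colored multigraph with color set `C`: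
each vertex has exactly one edge of each color, encoded as a fixed-point-free
involution for each color. -/
structure CGraph (C : Type) where
  V : Type
  finV : Finite V
  edge : V → C → V
  invol : ∀ v c, edge (edge v c) c = v
  no_loop : ∀ v c, edge v c ≠ v

attribute [instance] CGraph.finV

variable {C : Type}

/-- One-step adjacency in the subgraph keeping only the edges colored by `B`. -/
def step (G : CGraph C) (B : Set C) (v w : G.V) : Prop := ∃ c ∈ B, G.edge v c = w

/-- Reachability in the subgraph keeping only the edges colored by `B`. -/
def reaches (G : CGraph C) (B : Set C) : G.V → G.V → Prop :=
  Relation.ReflTransGen (step G B)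

/-- The number `g_B` of connected components of the subgraph with colors in `B`. -/
noncomputable def gB (G : CGraph C) (B : Set C) : ℕ := Nat.card (Quot (step G B))

def Connected (G : CGraph C) : Prop :=
  Nonempty G.V ∧ ∀ v w : G.V, reaches G Set.univ v w

def Bipartite (G : CGraph C) : Prop :=
  ∃ f : G.V → Bool, ∀ v c, f (G.edge v c) ≠ f v

/-- The (unordered) pair of cyclically consecutive colors at position `j` of the list `L`. -/
def pairSet (L : List C) (j : ℕ) : Set C :=
  {c | L[j % L.length]? = some c ∨ L[(j + 1) % L.length]? = some c}

/-- The regular genus of the subgraph of `G` colored by the entries of the list `L`,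
with respect to the cyclic order given by `L` (summed over connected components):
it is defined by `2 g - 2 ρ = Σ_j g_{L_j, L_{j+1}} + (2 - n) p`, where `n` is the
number of colors in `L`, `2p` the number of vertices and `g` the number of
connected components of the `L`-colored subgraph. -/
noncomputable def rhoL (G : CGraph C) (L : List C) : ℚ :=
  (gB G {c | c ∈ L} : ℚ) -
    ((∑ j ∈ Finset.range L.length, (gB G (pairSet L j) : ℚ)) +
      (2 - (L.length : ℚ)) * ((Nat.card G.V : ℚ) / 2)) / 2

/-- The listing of the colors determined by a permutation (a "cyclic permutation"
of the color set). -/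
def permList {n : ℕ} (ε : Equiv.Perm (Fin n)) : List (Fin n) :=
  (List.finRange n).map ε

/-- The gluing relation defining the pseudocomplex associated to a colored graph:
take one `d`-simplex per vertex of the graph and glue the facets opposite to the
vertex labelled `c` of the simplices corresponding to `c`-adjacent vertices. -/
def glueRel (G : CGraph C) [Fintype C] :
    G.V × stdSimplex ℝ C → G.V × stdSimplex ℝ C → Prop := fun p q =>
  ∃ c : C, (p.2 : C → ℝ) c = 0 ∧ q.1 = G.edge p.1 c ∧ (q.2 : C → ℝ) = (p.2 : C → ℝ)

instance (G : CGraph C) : TopologicalSpace G.V := ⊥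

/-- The topological space `|K(Γ)|` underlying the pseudocomplex associated to `Γ`. -/
abbrev Space (G : CGraph C) [Fintype C] : Type := Quot (glueRel G)

/-- The connected component ("residue") of the vertex `v` in the subgraph of `G`
obtained by deleting all `c`-colored edges, as a colored graph over the remaining colors. -/
def residue (G : CGraph C) (c : C) (v : G.V) : CGraph {c' : C // c' ≠ c} where
  V := {w : G.V // reaches G {c}ᶜ v w}
  finV := Subtype.finite
  edge := fun w c' =>
    ⟨G.edge w.1 c'.1, w.2.tail ⟨c'.1, Set.mem_compl_singleton_iff.mpr c'.2, rfl⟩⟩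
  invol := fun w c' => Subtype.ext (G.invol w.1 c'.1)
  no_loop := fun w c' h => G.no_loop w.1 c'.1 (congrArg Subtype.val h)

/-- `X` is locally Euclidean of dimension `n`. -/
def IsLocEuclidean (n : ℕ) (X : Type*) [TopologicalSpace X] : Prop :=
  ∀ x : X, ∃ (U : Set X) (W : Set (EuclideanSpace ℝ (Fin n))),
    IsOpen U ∧ IsOpen W ∧ x ∈ U ∧ Nonempty (U ≃ₜ W)

/-- `X` is a closed connected topological `n`-manifold. -/
def IsClosedMfld (n : ℕ) (X : Type*) [TopologicalSpace X] : Prop :=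
  CompactSpace X ∧ ConnectedSpace X ∧ IsLocEuclidean n X

/-- `Γ` represents a singular `d`-manifold: for every color `c`, every
`ĉ`-residue of `Γ` represents a closed connected `(d-1)`-manifold. -/
def IsSingularRep (d : ℕ) (G : CGraph (Fin (d + 1))) : Prop :=
  ∀ (c : Fin (d + 1)) (v : G.V), IsClosedMfld (d - 1) (Space (residue G c v))

/-- The `n`-sphere. -/
abbrev Sph (n : ℕ) : Type := ↥(Metric.sphere (0 : EuclideanSpace ℝ (Fin (n + 1))) 1)

/-- The closed `n`-disk. -/
abbrev Disk (n : ℕ) : Type := ↥(Metric.closedBall (0 : EuclideanSpace ℝ (Fin n)) 1)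

/-- `Γ` represents the (singular `d`-manifold) `X`. -/
def Represents (d : ℕ) (G : CGraph (Fin (d + 1))) (X : Type*) [TopologicalSpace X] : Prop :=
  Connected G ∧ IsSingularRep d G ∧ Nonempty (Space G ≃ₜ X)

/-- The generalized regular genus of the singular manifold `X`:
the infimum of the regular genera of colored graphs representing `X`. -/
noncomputable def sGenus (d : ℕ) (X : Type*) [TopologicalSpace X] : ℝ :=
  sInf {x : ℝ | ∃ (G : CGraph (Fin (d + 1))) (ε : Equiv.Perm (Fin (d + 1))),
    Represents d G X ∧ x = (rhoL G (permList ε) : ℝ)}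

/-- The minimal regular genus of the graph `G` over all cyclic permutations. -/
noncomputable def rhoMin (d : ℕ) (G : CGraph (Fin (d + 1))) : ℝ :=
  sInf {x : ℝ | ∃ ε : Equiv.Perm (Fin (d + 1)), x = (rhoL G (permList ε) : ℝ)}

/-- The Gurau degree of a `(d+1)`-colored graph: the sum of the regular genera over
all `d!/2` cyclic permutations of the colors up to inverse.  (Summing over all
`(d+1)!` permutations counts each such class `2(d+1)` times.) -/
noncomputable def omegaG (d : ℕ) (G : CGraph (Fin (d + 1))) : ℚ :=
  (∑ ε : Equiv.Perm (Fin (d + 1)), rhoL G (permList ε)) / (2 * (d + 1) : ℚ)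

/-- The Gurau degree of the singular manifold `X`. -/
noncomputable def sDegree (d : ℕ) (X : Type*) [TopologicalSpace X] : ℝ :=
  sInf {x : ℝ | ∃ G : CGraph (Fin (d + 1)), Represents d G X ∧ x = (omegaG d G : ℝ)}

/-- The Euler characteristic of the pseudocomplex `K(Γ)`: the `k`-simplices of
`K(Γ)` correspond to the residues of `Γ` over the complements of the
`(k+1)`-element sets of colors. -/
noncomputable def eulerChar (d : ℕ) (G : CGraph (Fin (d + 1))) : ℤ :=
  ∑ B ∈ (Finset.univ : Finset (Fin (d + 1))).powerset.erase Finset.univ,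
    (-1 : ℤ) ^ (d - B.card) * gB G ↑B

end Cryst

namespace Cryst

variable {C : Type}

/-- `H¹(S; ℤ/2)` vanishes in the Čech sense: every `ℤ/2`-valued continuous cocycle subordinate
to a family of open sets covering `S` is a coboundary. -/
def CechTrivialOn {X : Type} [TopologicalSpace X] (S : Set X) : Prop :=
  ∀ (ι : Type) (N : ι → Set X) (g : ι → ι → X → ZMod 2),
    (∀ i, IsOpen (N i)) → (∀ y ∈ S, ∃ i, y ∈ N i) →
    (∀ i j, ContinuousOn (g i j) (N i ∩ N j ∩ S)) →
    (∀ i j k, ∀ y ∈ S, y ∈ N i → y ∈ N j → y ∈ N k → g i j y + g j k y = g i k y) →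
    ∃ k : ι → X → ZMod 2, (∀ i, ContinuousOn (k i) (N i ∩ S)) ∧
      ∀ i j, ∀ y ∈ S, y ∈ N i → y ∈ N j → k i y + k j y = g i j y

theorem exists_cech_primitive {Y ι : Type} [TopologicalSpace Y] [SimplyConnectedSpace Y]
    [LocallyPathConnectedSpace Y] (N : ι → Set Y) (g : ι → ι → Y → ZMod 2)
    (hN : ∀ i, IsOpen (N i)) (hcov : ∀ y, ∃ i, y ∈ N i)
    (hg : ∀ i j, ContinuousOn (g i j) (N i ∩ N j))
    (hcoc : ∀ i j k y, y ∈ N i → y ∈ N j → y ∈ N k → g i j y + g j k y = g i k y) :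
    ∃ k : ι → Y → ZMod 2, (∀ i, ContinuousOn (k i) (N i)) ∧
      ∀ i j y, y ∈ N i → y ∈ N j → k i y + k j y = g i j y := by
  choose ix hix using hcov
  have hadd (i j : ι) : ContinuousOn (fun p : Y × ZMod 2 => p.2 + g i j p.1)
      ((N i ∩ N j) ×ˢ Set.univ) := by
    have h2 : ContinuousOn (fun p : Y × ZMod 2 => p.2) ((N i ∩ N j) ×ˢ Set.univ) :=
      continuousOn_snd
    exact h2.add ((hg i j).comp continuousOn_fst fun p hp => hp.1)
  let Z : FiberBundleCore ι Y (ZMod 2) :=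
    { baseSet := N
      isOpen_baseSet := hN
      indexAt := ix
      mem_baseSet_at := hix
      coordChange := fun i j y v => v + g i j y
      coordChange_self := fun i x hx v => by
        simpa using hcoc i i i x hx hx hx
      continuousOn_coordChange := hadd
      coordChange_comp := fun i j k x hx v => by
        rw [add_assoc, hcoc i j k x hx.1.1 hx.1.2 hx.2] }
  have hcover : IsCoveringMap (Bundle.TotalSpace.proj : Z.TotalSpace → Y) :=
    FiberBundle.isCoveringMap (F := ZMod 2) (E := Z.Fiber)
  obtain ⟨y₀⟩ : Nonempty Y := inferInstance
  obtain ⟨s, ⟨-, hs⟩, -⟩ := hcover.existsUnique_continuousMap_lifts (ContinuousMap.id Y)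
    (a₀ := y₀) (e₀ := (⟨y₀, (0 : ZMod 2)⟩ : Z.TotalSpace)) rfl
  have hs' (y : Y) : (s y).proj = y := congrFun hs y
  refine ⟨fun i y => (Z.localTriv i (s y)).2, fun i => ?_, fun i j y hi hj => ?_⟩
  · refine continuous_snd.comp_continuousOn
      ((Z.localTriv i).continuousOn_toFun.comp s.continuous.continuousOn fun y hy => ?_)
    change (s y).proj ∈ N i
    rwa [hs']
  · obtain ⟨v, hv⟩ : ∃ v : ZMod 2, v = (s y).snd := ⟨_, rfl⟩
    have e (i : ι) : (Z.localTriv i (s y)).2 = v + g (ix y) i y := by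
      have h : (Z.localTriv i (s y)).2 = v + g (ix (s y).proj) i (s y).proj := by
        rw [hv]; rfl
      rw [h, hs']
    change (Z.localTriv i (s y)).2 + (Z.localTriv j (s y)).2 = _
    rw [e, e, ← hcoc (ix y) i j y (hix y) hi hj]
    linear_combination (CharTwo.add_self_eq_zero v) +
      CharTwo.add_self_eq_zero (g (ix y) i y)

theorem cechTrivialOn_of_simplyConnected {X : Type} [TopologicalSpace X] (S : Set X)
    [SimplyConnectedSpace S] [LocallyPathConnectedSpace S] : CechTrivialOn S := by
  intro ι N g hN hcov hg hcoc
  obtain ⟨k, hk, hkg⟩ := exists_cech_primitive (Y := S) (fun i => Subtype.val ⁻¹' N i)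
    (fun i j y => g i j y) (fun i => (hN i).preimage continuous_subtype_val)
    (fun y => hcov y y.2)
    (fun i j => (hg i j).comp continuous_subtype_val.continuousOn
      fun y hy => ⟨⟨hy.1, hy.2⟩, y.2⟩)
    (fun i j k y => hcoc i j k y y.2)
  refine ⟨fun i y => if h : y ∈ S then k i ⟨y, h⟩ else 0, fun i => ?_, fun i j y hy hi hj => ?_⟩
  · rw [continuousOn_iff_continuous_domRestrict]
    have : (N i ∩ S).domRestrict (fun y => if h : y ∈ S then k i ⟨y, h⟩ else 0) =
        fun y : ↥(N i ∩ S) => k i ⟨y, y.2.2⟩ := by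
      funext y
      simp [Set.domRestrict, y.2.2]
    exact this ▸ (hk i).comp_continuous (by fun_prop) fun y => y.2.1
  · simpa [hy] using hkg i j ⟨y, hy⟩ hi hj

theorem CechTrivialOn.union {X : Type} [TopologicalSpace X] {A B : Set X}
    (hA : CechTrivialOn A) (hB : CechTrivialOn B) (oA : IsOpen A) (oB : IsOpen B)
    (hAB : IsPreconnected (A ∩ B)) : CechTrivialOn (A ∪ B) := by
  intro ι N g hN hcov hg hcoc
  obtain ⟨k, hk, hkg⟩ := hA ι N g hN (fun y hy => hcov y (.inl hy))
    (fun i j => (hg i j).mono (Set.inter_subset_inter_right _ Set.subset_union_left))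
    (fun i j k y hy => hcoc i j k y (.inl hy))
  obtain ⟨l, hl, hlg⟩ := hB ι N g hN (fun y hy => hcov y (.inr hy))
    (fun i j => (hg i j).mono (Set.inter_subset_inter_right _ Set.subset_union_right))
    (fun i j k y hy => hcoc i j k y (.inr hy))
  have key : ∃ c : ZMod 2, ∀ i, ∀ y ∈ N i, y ∈ A → y ∈ B → k i y = l i y + c := by
    by_cases hne : (A ∩ B).Nonempty
    swap
    · exact ⟨0, fun i y _ ha hb => (hne ⟨y, ha, hb⟩).elim⟩
    have : Nonempty ι := ⟨(hcov hne.some (.inl hne.some_mem.1)).choose⟩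
    choose! ix hix using hcov
    let d : X → ZMod 2 := fun y => k (ix y) y + l (ix y) y
    have hd : ∀ i, ∀ y ∈ N i, y ∈ A → y ∈ B → k i y + l i y = d y := by
      intro i y hi ha hb
      have h1 := hkg i (ix y) y ha hi (hix y (.inl ha))
      have h2 := hlg i (ix y) y hb hi (hix y (.inl ha))
      linear_combination h1 - h2 - CharTwo.add_self_eq_zero (k (ix y) y)
        + CharTwo.add_self_eq_zero (l i y)
    have hdc : ContinuousOn d (A ∩ B) := by
      intro y hy
      have hi := hix y (.inl hy.1)
      have nh : N (ix y) ∩ A ∩ B ∈ nhds y :=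
        (((hN _).inter oA).inter oB).mem_nhds ⟨⟨hi, hy.1⟩, hy.2⟩
      have hc : ContinuousOn (fun z => k (ix y) z + l (ix y) z) (N (ix y) ∩ A ∩ B) :=
        ((hk _).mono fun z hz => hz.1).add ((hl _).mono fun z hz => ⟨hz.1.1, hz.2⟩)
      exact ((hc.congr fun z hz => (hd _ z hz.1.1 hz.1.2 hz.2).symm).continuousAt
        nh).continuousWithinAt
    obtain ⟨y₀, hy₀⟩ := hne
    refine ⟨d y₀, fun i y hi ha hb => ?_⟩
    rw [← hAB.constant hdc ⟨ha, hb⟩ hy₀, ← hd i y hi ha hb]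
    linear_combination -CharTwo.add_self_eq_zero (l i y)
  obtain ⟨c, hc⟩ := key
  refine ⟨fun i y => if y ∈ A then k i y else l i y + c, fun i y hy => ?_,
    fun i j y hy hi hj => ?_⟩
  · rcases hy.2 with ha | hb
    · refine (((hk i).congr fun z hz => if_pos hz.2).continuousAt
        (((hN i).inter oA).mem_nhds ⟨hy.1, ha⟩)).continuousWithinAt
    · refine ((((hl i).add (continuousOn_const (c := c))).congr fun z hz => ?_).continuousAt
        (((hN i).inter oB).mem_nhds ⟨hy.1, hb⟩)).continuousWithinAt
      · by_cases ha : z ∈ A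
        · simpa [ha] using hc i z hz.1 ha hz.2
        · simp [ha]
  · by_cases ha : y ∈ A
    · simpa [ha] using hkg i j y ha hi hj
    · have hb := hy.resolve_left ha
      simp only [ha, if_false]
      rw [← hlg i j y hb hi hj]
      linear_combination CharTwo.add_self_eq_zero c

theorem cechTrivialOn_compl_zero {E : Type} [NormedAddCommGroup E] [NormedSpace ℝ E]
    (hE : 2 < Module.rank ℝ E) : CechTrivialOn ({0}ᶜ : Set E) := by
  have : Nontrivial E := by
    rw [← rank_pos_iff_nontrivial (R := ℝ)]
    exact lt_trans (by norm_num) hE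
  have := IsAddTorsionFree.of_isTorsionFree ℝ E
  obtain ⟨e, he⟩ := exists_norm_eq E (c := (1 : ℝ)) zero_le_one
  have he0 : e ≠ 0 := by rintro rfl; simp at he
  let A : E → Set E := fun u => {y | y ≠ ‖y‖ • u}
  have oA (u : E) : IsOpen (A u) := isOpen_ne_fun (by fun_prop) (by fun_prop)
  have hA (u : E) (hu : ‖u‖ = 1) : CechTrivialOn (A u) := by
    have hu0 : u ≠ 0 := by rintro rfl; simp at hu
    have hmem : -u ∈ A u := by
      simp only [A, Set.mem_ofPred_eq, norm_neg, hu, one_smul, ne_eq, neg_eq_self]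
      exact hu0
    have hstar : StarConvex ℝ (-u) (A u) := by
      intro y hy a b ha hb hab h
      refine hy ?_
      set t := ‖a • -u + b • y‖
      have h0 : b • y = (t + a) • u := by
        rw [add_smul, ← h]; simp
      rcases hb.eq_or_lt with rfl | hb
      · have hz : t + a = 0 := by simpa [hu0] using h0.symm
        have : 0 ≤ t := norm_nonneg _
        linarith
      · have hy' : y = ((t + a) / b) • u := by
          rw [div_eq_inv_mul, mul_smul, ← h0, inv_smul_smul₀ hb.ne']
        have hpos : 0 ≤ (t + a) / b := by positivity
        rw [hy', norm_smul, hu, mul_one, Real.norm_of_nonneg hpos]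
    have := hstar.contractibleSpace ⟨_, hmem⟩
    have := (oA u).locallyPathConnectedSpace
    exact cechTrivialOn_of_simplyConnected _
  have hunion : ({0}ᶜ : Set E) = A e ∪ A (-e) := by
    ext y
    simp only [A, Set.mem_compl_iff, Set.mem_singleton_iff, Set.mem_union, Set.mem_ofPred_eq]
    constructor
    · intro hy
      by_contra! h
      refine hy ?_
      have h2 := h.1.symm.trans h.2
      rw [smul_neg, self_eq_neg, smul_eq_zero] at h2
      simpa [he0] using h2
    · rintro h rfl
      simp at h
  have hinter : A e ∩ A (-e) = ((ℝ ∙ e : Submodule ℝ E) : Set E)ᶜ := by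
    ext y
    simp only [A, Set.mem_inter_iff, Set.mem_ofPred_eq, Set.mem_compl_iff, SetLike.mem_coe,
      Submodule.mem_span_singleton]
    constructor
    · rintro ⟨h1, h2⟩ ⟨t, rfl⟩
      rcases le_total 0 t with ht | ht
      · simp [norm_smul, he, abs_of_nonneg ht] at h1
      · simp [norm_smul, he, abs_of_nonpos ht] at h2
    · intro h
      exact ⟨fun h1 => h ⟨_, h1.symm⟩,
        fun h2 => h ⟨-‖y‖, by rw [neg_smul, ← smul_neg]; exact h2.symm⟩⟩
  rw [hunion]
  refine (hA e he).union (hA (-e) (by simpa using he)) (oA _) (oA _) ?_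
  rw [hinter]
  refine (isConnected_compl_of_one_lt_codim ?_).isPreconnected
  have h1 := Submodule.rank_quotient_add_rank (ℝ ∙ e : Submodule ℝ E)
  by_contra! h2
  have h3 : Module.rank ℝ (ℝ ∙ e : Submodule ℝ E) ≤ 1 := by
    simpa using rank_span_le (R := ℝ) ({e} : Set E)
  have := add_le_add h2 h3
  rw [h1] at this
  norm_num at this
  exact absurd hE (not_lt.mpr (by simpa [one_add_one_eq_two] using this))

theorem exists_centered_chart {E X : Type} [NormedAddCommGroup E] [InnerProductSpace ℝ E]
    [TopologicalSpace X] {U : Set X} {W : Set E} (hU : IsOpen U) (hW : IsOpen W) (e : U ≃ₜ W)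
    {x : X} (hx : x ∈ U) {S : Set X} (hS : IsOpen S) (hxS : x ∈ S) :
    ∃ φ : OpenPartialHomeomorph X E, x ∈ φ.source ∧ φ.source ⊆ S ∧ φ.target = Set.univ ∧
      φ x = 0 := by
  have hU' : Nonempty (TopologicalSpace.Opens.mk U hU) := ⟨⟨x, hx⟩⟩
  have hW' : Nonempty (TopologicalSpace.Opens.mk W hW) := ⟨e ⟨x, hx⟩⟩
  let f : OpenPartialHomeomorph X E :=
    (((TopologicalSpace.Opens.mk U hU).openPartialHomeomorphSubtypeCoe hU').symm.trans
      (e.toOpenPartialHomeomorph.trans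
        ((TopologicalSpace.Opens.mk W hW).openPartialHomeomorphSubtypeCoe hW'))).restrOpen S hS
  have hxf : x ∈ f.source := by
    simp [f, hx, hxS]
  have hfS : f.source ⊆ S := by
    intro y hy
    simp only [f, OpenPartialHomeomorph.restrOpen_source] at hy
    exact hy.2
  obtain ⟨r, hr, hball⟩ := Metric.isOpen_iff.mp f.open_target (f x) (f.map_source hxf)
  refine ⟨f.trans (OpenPartialHomeomorph.univBall (f x) r).symm, ?_, ?_, ?_, ?_⟩
  · simp [OpenPartialHomeomorph.univBall_target _ hr, hxf, hr]
  · exact fun y hy => hfS (by simpa using hy.1)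
  · rw [OpenPartialHomeomorph.trans_target]
    ext z
    simp only [OpenPartialHomeomorph.symm_target, OpenPartialHomeomorph.univBall_source,
      OpenPartialHomeomorph.symm_symm, Set.mem_inter_iff, Set.mem_univ, true_and, iff_true]
    apply hball
    rw [← OpenPartialHomeomorph.univBall_target _ hr]
    exact (OpenPartialHomeomorph.univBall (f x) r).map_source (by simp)
  · simp

section LocalTriviality

theorem reaches_edge (H : CGraph C) {B : Set C} {v w : H.V} (hw : reaches H B v w) {d : C}
    (hd : d ∈ B) : reaches H B v (H.edge w d) :=
  hw.tail ⟨d, hd, rfl⟩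

variable [Fintype C]

instance (G : CGraph C) : DiscreteTopology G.V := ⟨rfl⟩

/-- The point of `|K(Γ)|` with barycentric coordinates `y` in the simplex of the vertex `v`. -/
def Space.mk (H : CGraph C) (v : H.V) (y : stdSimplex ℝ C) : Space H := Quot.mk _ (v, y)

theorem Space.continuous_mk (H : CGraph C) (v : H.V) : Continuous (Space.mk H v) :=
  continuous_quot_mk.comp (by fun_prop)

theorem Space.mk_edge (H : CGraph C) (v : H.V) (y : stdSimplex ℝ C) {d : C}
    (hd : y.1 d = 0) : Space.mk H (H.edge v d) y = Space.mk H v y :=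
  (Quot.sound (show glueRel H (v, y) (H.edge v d, y) from ⟨d, hd, rfl, rfl⟩)).symm

/-- The barycentric coordinates of a point of `|K(Γ)|`. -/
def Space.coord (H : CGraph C) : Space H → C → ℝ :=
  Quot.lift (fun p => p.2.1) fun _ _ ⟨_, _, _, h⟩ => h.symm

theorem Space.continuous_coord (H : CGraph C) (d : C) :
    Continuous fun X : Space H => Space.coord H X d := by
  refine isQuotientMap_quot_mk.continuous_iff.mpr ?_
  exact (continuous_apply d).comp (continuous_subtype_val.comp continuous_snd)

/-- The open star of the vertex labelled `o` of the simplex of `v₀`. -/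
def openStar (H : CGraph C) (o : C) (v₀ : H.V) : Set (Space H) :=
  {X | ∃ (w : H.V) (y : stdSimplex ℝ C), reaches H {o}ᶜ v₀ w ∧ 0 < y.1 o ∧ X = Space.mk H w y}

theorem isOpen_openStar (H : CGraph C) (o : C) (v₀ : H.V) : IsOpen (openStar H o v₀) := by
  rw [← isQuotientMap_quot_mk.isOpen_preimage]
  let P : H.V × stdSimplex ℝ C → Prop := fun p => reaches H {o}ᶜ v₀ p.1 ∧ 0 < p.2.1 o
  have hP : ∀ p q, glueRel H p q → P p = P q := by
    rintro ⟨v, y⟩ ⟨w, z⟩ ⟨d, hd, hw, hz⟩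
    obtain rfl : z = y := Subtype.ext hz
    obtain rfl : w = H.edge v d := hw
    refine propext (and_congr_left fun h => ?_)
    have hdo : d ∈ ({o}ᶜ : Set C) := by
      rintro rfl
      exact h.ne' hd
    refine ⟨fun hv => reaches_edge H hv hdo, fun hv => ?_⟩
    simpa [H.invol] using reaches_edge H hv hdo
  have : Quot.mk (glueRel H) ⁻¹' openStar H o v₀ = {p | P p} := by
    ext p
    constructor
    · rintro ⟨w, y, hw, hy, h⟩
      have h' := congrArg (Quot.lift P hP) h
      exact (show P p = P (w, y) from h').mpr ⟨hw, hy⟩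
    · exact fun h => ⟨p.1, p.2, h.1, h.2, rfl⟩
  rw [this]
  exact (isOpen_discrete {w | reaches H {o}ᶜ v₀ w}).preimage continuous_fst |>.inter
    (isOpen_lt continuous_const
      ((continuous_apply o).comp (continuous_subtype_val.comp continuous_snd)))

/-- The difference of the functions `h i` and `h j`, spread over the part of `|K(Γ)|` where the
coordinates `i`, `j` and `o` are positive. -/
noncomputable def overlap (H : CGraph C) (o : C) (h : C → H.V → ZMod 2)
    (i j : C) (hinv : ∀ d v, d ≠ o → d ≠ i → d ≠ j →
      h i (H.edge v d) + h j (H.edge v d) = h i v + h j v) : Space H → ZMod 2 :=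
  Quot.lift (fun p => if 0 < p.2.1 i ∧ 0 < p.2.1 j ∧ 0 < p.2.1 o then
      h i p.1 + h j p.1 else 0) <| by
    rintro ⟨v, y⟩ ⟨w, z⟩ ⟨d, hd, hw, hz⟩
    obtain rfl : z = y := Subtype.ext hz
    obtain rfl : w = H.edge v d := hw
    dsimp only at hd ⊢
    split_ifs with hc
    · refine (hinv d v ?_ ?_ ?_).symm <;> rintro rfl
      exacts [hc.2.2.ne' hd, hc.1.ne' hd, hc.2.1.ne' hd]
    · rfl

theorem overlap_mk (H : CGraph C) (o : C) (h : C → H.V → ZMod 2)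
    (i j : C) (hinv : ∀ d v, d ≠ o → d ≠ i → d ≠ j →
      h i (H.edge v d) + h j (H.edge v d) = h i v + h j v) (v : H.V)
    (y : stdSimplex ℝ C) (hi : 0 < y.1 i) (hj : 0 < y.1 j)
    (ho : 0 < y.1 o) :
    overlap H o h i j hinv (Space.mk H v y) = h i v + h j v :=
  if_pos ⟨hi, hj, ho⟩

theorem continuousOn_overlap (H : CGraph C) (o : C) (h : C → H.V → ZMod 2)
    (i j : C) (hinv : ∀ d v, d ≠ o → d ≠ i → d ≠ j →
      h i (H.edge v d) + h j (H.edge v d) = h i v + h j v) :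
    ContinuousOn (overlap H o h i j hinv)
      {X | 0 < Space.coord H X i ∧ 0 < Space.coord H X j ∧ 0 < Space.coord H X o} := by
  have hopen (d : C) := isOpen_lt continuous_const (Space.continuous_coord H d) (f := fun _ => 0)
  have hO : IsOpen
      {X | 0 < Space.coord H X i ∧ 0 < Space.coord H X j ∧ 0 < Space.coord H X o} :=
    (hopen i).inter ((hopen j).inter (hopen o))
  rw [continuousOn_open_iff hO]
  intro t ht
  rw [← isQuotientMap_quot_mk.isOpen_preimage]
  have hc (d : C) : IsOpen {p : H.V × stdSimplex ℝ C | 0 < p.2.1 d} :=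
    isOpen_lt continuous_const ((continuous_apply d).comp (continuous_subtype_val.comp continuous_snd))
  have ht' : IsOpen {p : H.V × stdSimplex ℝ C | h i p.1 + h j p.1 ∈ t} :=
    (isOpen_discrete {v | h i v + h j v ∈ t}).preimage continuous_fst
  convert ((hc i).inter ((hc j).inter (hc o))).inter ht' using 1
  ext p
  refine and_congr_right fun hp => ?_
  change overlap H o h i j hinv (Space.mk H p.1 p.2) ∈ t ↔ _
  rw [overlap_mk H o h i j hinv p.1 p.2 hp.1 hp.2.1 hp.2.2]
  rfl

/-- The vertex labelled `o` of the standard simplex. -/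
noncomputable def corner (o : C) : stdSimplex ℝ C := ⟨Pi.single o 1, single_mem_stdSimplex ℝ o⟩

theorem mk_corner_eq (H : CGraph C) (o : C) (v₀ w : H.V) (hw : reaches H {o}ᶜ v₀ w) :
    Space.mk H w (corner o) = Space.mk H v₀ (corner o) := by
  induction hw with
  | refl => rfl
  | tail _ hbc ih =>
    obtain ⟨d, hd, rfl⟩ := hbc
    rw [Space.mk_edge H _ _ (Pi.single_eq_of_ne hd _), ih]

theorem eq_corner {o : C} {y : stdSimplex ℝ C} (hy : ∀ i, i ≠ o → y.1 i ≤ 0) :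
    y = corner o := by
  have hz (i : C) (hi : i ≠ o) : y.1 i = 0 := le_antisymm (hy i hi) (y.2.1 i)
  have hs := y.2.2
  rw [Finset.sum_eq_single o (fun i _ hi => hz i hi) (by simp)] at hs
  refine Subtype.ext (funext fun i => ?_)
  by_cases hi : i = o
  · subst hi
    simpa [corner] using hs
  · simp [corner, hi, hz]

theorem exists_corner_nhd {o : C} {s : Set (stdSimplex ℝ C)} (hs : IsOpen s)
    (ho : corner o ∈ s) : ∃ δ > 0, ∀ y : stdSimplex ℝ C, 1 - δ < y.1 o → y ∈ s := by
  obtain ⟨δ, hδ, hball⟩ := Metric.isOpen_iff.mp hs _ ho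
  refine ⟨δ, hδ, fun y hy => hball ?_⟩
  rw [Metric.mem_ball, Subtype.dist_eq, dist_pi_lt_iff hδ]
  intro i
  have hle : y.1 o ≤ 1 := stdSimplex.le_one y o
  by_cases hi : i = o
  · subst hi
    simp only [corner, Pi.single_eq_same, Real.dist_eq]
    rw [abs_sub_lt_iff]
    constructor <;> linarith
  · have h0 := y.2.1 i
    have h1 : y.1 i + y.1 o ≤ 1 := by
      rw [← y.2.2, ← Finset.sum_pair hi]
      exact Finset.sum_le_sum_of_subset_of_nonneg (Finset.subset_univ _) fun j _ _ => y.2.1 j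
    simp only [corner, Pi.single_eq_of_ne hi, Real.dist_eq, sub_zero]
    rw [abs_of_nonneg h0]
    linarith

/-- The point at parameter `t` of the segment from the vertex `o` to `u`. -/
noncomputable def nearCorner (o : C) (t : Set.Icc (0 : ℝ) 1) (u : stdSimplex ℝ C) :
    stdSimplex ℝ C :=
  ⟨(1 - (t : ℝ)) • (corner o).1 + (t : ℝ) • u.1,
    convex_stdSimplex ℝ C (corner o).2 u.2 (by linarith [t.2.2]) t.2.1 (by ring)⟩

theorem isPreconnected_corner (o i : C) (δ : ℝ) :
    IsPreconnected {y : stdSimplex ℝ C | 1 - δ < y.1 o ∧ 0 < y.1 i} := by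
  rw [← Topology.IsInducing.subtypeVal.isPreconnected_image]
  have hconv : Convex ℝ (stdSimplex ℝ C ∩ ({y | 1 - δ < y o} ∩ {y | 0 < y i})) :=
    (convex_stdSimplex ℝ C).inter
      ((convex_halfSpace_gt (LinearMap.proj (R := ℝ) (φ := fun _ : C => ℝ) o).isLinear _).inter
        (convex_halfSpace_gt (LinearMap.proj (R := ℝ) (φ := fun _ : C => ℝ) i).isLinear _))
  convert hconv.isPreconnected using 1
  ext y
  constructor
  · rintro ⟨z, hz, rfl⟩
    exact ⟨z.2, hz⟩
  · rintro ⟨hy, hz⟩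
    exact ⟨⟨y, hy⟩, hz, rfl⟩

/-- If the vertex of `|K(Γ)|` labelled `o` in the simplex of `v₀` has a Euclidean neighbourhood,
then its link has trivial first cohomology modulo two. -/
theorem exists_link_primitive (H : CGraph C) (o : C) (hloc : IsLocEuclidean 3 (Space H))
    (v₀ : H.V) (h : C → H.V → ZMod 2)
    (hinv : ∀ i j d v, i ≠ o → j ≠ o → d ≠ o → d ≠ i → d ≠ j →
      h i (H.edge v d) + h j (H.edge v d) = h i v + h j v) :
    ∃ f : H.V → ZMod 2, ∀ w, reaches H {o}ᶜ v₀ w → ∀ i d, i ≠ o → d ≠ o → d ≠ i →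
      f (H.edge w d) + h i (H.edge w d) = f w + h i w := by
  by_cases hne : ∃ i₀ : C, i₀ ≠ o
  swap
  · exact ⟨0, fun w _ i d hi => (hne ⟨i, hi⟩).elim⟩
  obtain ⟨i₀, hi₀⟩ := hne
  set x := Space.mk H v₀ (corner o)
  have hxS : x ∈ openStar H o v₀ := ⟨v₀, corner o, .refl, by simp [corner], rfl⟩
  obtain ⟨U, W, hU, hW, hxU, ⟨e⟩⟩ := hloc x
  obtain ⟨φ, hxφ, hφS, hφt, hφx⟩ :=
    exists_centered_chart hU hW e hxU (isOpen_openStar H o v₀) hxS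
  have hsymm : Continuous φ.symm := by
    have := φ.continuousOn_symm
    rwa [hφt, continuousOn_univ] at this
  have hsource (z) : φ.symm z ∈ φ.source := φ.map_target (hφt ▸ Set.mem_univ z)
  have hrank : 2 < Module.rank ℝ (EuclideanSpace ℝ (Fin 3)) := by
    rw [← Module.finrank_eq_rank, finrank_euclideanSpace_fin]
    norm_num
  obtain ⟨k, hk, hkg⟩ := cechTrivialOn_compl_zero hrank {i : C // i ≠ o}
    (fun i => {z | 0 < Space.coord H (φ.symm z) i})
    (fun i j z => overlap H o h i j (hinv i j · · i.2 j.2) (φ.symm z))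
    (fun i => isOpen_lt continuous_const ((Space.continuous_coord H i).comp hsymm))
    (fun z hz => by
      by_contra! hcon
      obtain ⟨w, y, hw, -, hwy⟩ := hφS (hsource z)
      have hy : y = corner o := eq_corner fun i hi => by
        have := hcon ⟨i, hi⟩
        simp only [Set.mem_ofPred_eq, not_lt, hwy] at this
        exact this
      rw [hy, mk_corner_eq H o v₀ w hw] at hwy
      refine hz ?_
      rw [Set.mem_singleton_iff, ← hφx]
      exact (φ.right_inv (hφt ▸ Set.mem_univ z)).symm.trans (congrArg φ hwy))
    (fun i j => (continuousOn_overlap H o h i j (hinv i j · · i.2 j.2)).comp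
        hsymm.continuousOn fun z hz => by
      obtain ⟨w, y, -, hy, hwy⟩ := hφS (hsource z)
      refine ⟨hz.1.1, hz.1.2, ?_⟩
      rw [hwy]
      exact hy)
    (fun i j l z _ hi hj hl => by
      obtain ⟨w, y, -, hy, hwy⟩ := hφS (hsource z)
      simp only [Set.mem_ofPred_eq, hwy] at hi hj hl ⊢
      rw [overlap_mk H o h i j (hinv i j · · i.2 j.2) w y hi hj hy,
        overlap_mk H o h j l (hinv j l · · j.2 l.2) w y hj hl hy,
        overlap_mk H o h i l (hinv i l · · i.2 l.2) w y hi hl hy]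
      linear_combination CharTwo.add_self_eq_zero (h j w))
  obtain ⟨δ, hδ, hmem⟩ : ∃ δ > 0, ∀ w, reaches H {o}ᶜ v₀ w → ∀ y : stdSimplex ℝ C,
      1 - δ < y.1 o → Space.mk H w y ∈ φ.source := by
    have (w : H.V) : ∃ δ > 0, reaches H {o}ᶜ v₀ w → ∀ y : stdSimplex ℝ C,
        1 - δ < y.1 o → Space.mk H w y ∈ φ.source := by
      by_cases hw : reaches H {o}ᶜ v₀ w
      · obtain ⟨δ, hδ, hs⟩ := exists_corner_nhd (o := o)
          (φ.open_source.preimage (Space.continuous_mk H w))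
          (by rw [Set.mem_preimage, mk_corner_eq H o v₀ w hw]; exact hxφ)
        exact ⟨δ, hδ, fun _ => hs⟩
      · exact ⟨1, one_pos, fun h => (hw h).elim⟩
    choose δ hδ hs using this
    have : Nonempty H.V := ⟨v₀⟩
    obtain ⟨w₀, hw₀⟩ := Finite.exists_min δ
    exact ⟨δ w₀, hδ w₀, fun w hw y hy => hs w hw y (by linarith [hw₀ w])⟩
  have hpunct (w) (hw : reaches H {o}ᶜ v₀ w) (i : {i : C // i ≠ o}) (y : stdSimplex ℝ C)
      (hyo : 1 - δ < y.1 o) (hyi : 0 < y.1 i) :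
      φ (Space.mk H w y) ∈ {z | 0 < Space.coord H (φ.symm z) i} ∩ {0}ᶜ := by
    refine ⟨?_, fun h0 => ?_⟩
    · rw [Set.mem_ofPred_eq, φ.left_inv (hmem w hw y hyo)]
      exact hyi
    · rw [Set.mem_singleton_iff, ← hφx] at h0
      have hx := congrArg (fun X => Space.coord H X i) (φ.injOn (hmem w hw y hyo) hxφ h0)
      have : y.1 i = (corner o).1 i := hx
      simp only [corner, Pi.single_eq_of_ne i.2] at this
      exact hyi.ne' this
  have hconst (w) (hw : reaches H {o}ᶜ v₀ w) (i : {i : C // i ≠ o}) (y z : stdSimplex ℝ C)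
      (hyo : 1 - δ < y.1 o) (hyi : 0 < y.1 i)
      (hzo : 1 - δ < z.1 o) (hzi : 0 < z.1 i) :
      k i (φ (Space.mk H w y)) = k i (φ (Space.mk H w z)) := by
    refine (isPreconnected_corner o i δ).constant (f := fun y => k i (φ (Space.mk H w y)))
      ?_ ⟨hyo, hyi⟩ ⟨hzo, hzi⟩
    exact (hk i).comp (φ.continuousOn.comp (Space.continuous_mk H w).continuousOn
      fun y hy => hmem w hw y hy.1) fun y hy => hpunct w hw i y hy.1 hy.2
  have hcard : (0 : ℝ) < Fintype.card C := by
    exact_mod_cast Fintype.card_pos_iff.mpr ⟨o⟩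
  let b : stdSimplex ℝ C := ⟨fun _ => (Fintype.card C : ℝ)⁻¹, fun _ => by positivity, by
    simp [hcard.ne']⟩
  have ht0 : 0 < min δ 1 := lt_min hδ one_pos
  let t : Set.Icc (0 : ℝ) 1 := ⟨min δ 1 / 2, by positivity, by linarith [min_le_right δ 1]⟩
  have htpos : 0 < (t : ℝ) := half_pos ht0
  have htδ : (t : ℝ) < δ := by
    change min δ 1 / 2 < δ
    linarith [min_le_left δ 1]
  have hnear (u : stdSimplex ℝ C) : 1 - δ < (nearCorner o t u).1 o := by
    have := u.2.1 o
    simp only [nearCorner, corner, Pi.add_apply, Pi.smul_apply, Pi.single_eq_same, smul_eq_mul]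
    nlinarith
  have hnear_ne (u : stdSimplex ℝ C) (i : C) (hi : i ≠ o) :
      (nearCorner o t u).1 i = t * u.1 i := by
    simp [nearCorner, corner, hi]
  have hbi (i : C) (hi : i ≠ o) : 0 < (nearCorner o t b).1 i := by
    rw [hnear_ne b i hi]
    exact mul_pos htpos (inv_pos.mpr hcard)
  have hbo : 0 < (nearCorner o t b).1 o := by
    simp only [nearCorner, corner, Pi.add_apply, Pi.smul_apply, Pi.single_eq_same, smul_eq_mul]
    have h1 := t.2.2
    have : 0 < (t : ℝ) * b.1 o := mul_pos htpos (inv_pos.mpr hcard)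
    linarith
  let f : H.V → ZMod 2 := fun w => k ⟨i₀, hi₀⟩ (φ (Space.mk H w (nearCorner o t b))) + h i₀ w
  have hf (w) (hw : reaches H {o}ᶜ v₀ w) (i : C) (hi : i ≠ o) :
      f w + h i w = k ⟨i, hi⟩ (φ (Space.mk H w (nearCorner o t b))) := by
    have h0 := hpunct w hw ⟨i₀, hi₀⟩ _ (hnear b) (hbi i₀ hi₀)
    have h1 := hpunct w hw ⟨i, hi⟩ _ (hnear b) (hbi i hi)
    have h2 := hkg ⟨i₀, hi₀⟩ ⟨i, hi⟩ _ h0.2 h0.1 h1.1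
    rw [φ.left_inv (hmem w hw _ (hnear b)),
      overlap_mk H o h i₀ i (hinv i₀ i · · hi₀ hi) w _ (hbi i₀ hi₀) (hbi i hi) hbo] at h2
    simp only [f]
    linear_combination -h2 +
      CharTwo.add_self_eq_zero (k ⟨i₀, hi₀⟩ (φ (Space.mk H w (nearCorner o t b))))
  refine ⟨f, fun w hw i d hi hdo hdi => ?_⟩
  have hw' : reaches H {o}ᶜ v₀ (H.edge w d) := reaches_edge H hw hdo
  have hci : 0 < (nearCorner o t (corner i)).1 i := by
    rw [hnear_ne _ i hi]
    simpa [corner] using htpos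
  have hcd : (nearCorner o t (corner i)).1 d = 0 := by
    rw [hnear_ne _ d hdo]
    simp [corner, hdi]
  rw [hf _ hw' i hi, hf _ hw i hi,
    hconst _ hw' ⟨i, hi⟩ _ (nearCorner o t (corner i)) (hnear b) (hbi i hi) (hnear _) hci,
    Space.mk_edge H w _ hcd,
    hconst _ hw ⟨i, hi⟩ _ (nearCorner o t b) (hnear _) hci (hnear b) (hbi i hi)]

end LocalTriviality

theorem reaches_symm (G : CGraph C) {B : Set C} {v w : G.V} (h : reaches G B v w) :
    reaches G B w v := by
  induction h with
  | refl => exact .refl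
  | tail _ h ih =>
    obtain ⟨d, hd, rfl⟩ := h
    exact .head ⟨d, hd, G.invol _ d⟩ ih

theorem reaches_of_quot_eq (G : CGraph C) {B : Set C} {v w : G.V}
    (h : Quot.mk (step G B) v = Quot.mk (step G B) w) : reaches G B v w := by
  have h' := Quot.eqvGen_exact h
  clear h
  induction h' with
  | rel _ _ h => exact .single h
  | refl => exact .refl
  | symm _ _ _ ih => exact reaches_symm G ih
  | trans _ _ _ _ _ ih₁ ih₂ => exact ih₁.trans ih₂

theorem residue_reaches (G : CGraph C) {e o : C} (ho : o ≠ e) {v₀ w : G.V}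
    (h : reaches G {e, o}ᶜ v₀ w) :
    ∃ hw : reaches G {e}ᶜ v₀ w,
      reaches (residue G e v₀) {⟨o, ho⟩}ᶜ ⟨v₀, .refl⟩ ⟨w, hw⟩ := by
  induction h with
  | refl => exact ⟨.refl, .refl⟩
  | tail _ h ih =>
    obtain ⟨d, hd, rfl⟩ := h
    obtain ⟨hw, hr⟩ := ih
    simp only [Set.mem_compl_iff, Set.mem_insert_iff, Set.mem_singleton_iff, not_or] at hd
    exact ⟨reaches_edge G hw hd.1,
      hr.tail ⟨⟨d, hd.1⟩, fun h => hd.2 (congrArg Subtype.val h), rfl⟩⟩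

/-- In a graph representing a singular `4`-manifold, the `{e, o}ᶜ`-residues have trivial first
cohomology modulo two. -/
theorem IsSingularRep.exists_primitive {G : CGraph (Fin 5)} (hG : IsSingularRep 4 G)
    {e o : Fin 5} (ho : o ≠ e) (h : Fin 5 → G.V → ZMod 2)
    (hinv : ∀ i j d v, i ≠ e → i ≠ o → j ≠ e → j ≠ o → d ≠ e → d ≠ o → d ≠ i → d ≠ j →
      h i (G.edge v d) + h j (G.edge v d) = h i v + h j v) :
    ∃ f : G.V → ZMod 2, ∀ w i d, i ≠ e → i ≠ o → d ≠ e → d ≠ o → d ≠ i →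
      f (G.edge w d) + h i (G.edge w d) = f w + h i w := by
  have key (v₀ : G.V) : ∃ f : G.V → ZMod 2, ∀ w, reaches G {e, o}ᶜ v₀ w → ∀ i d, i ≠ e →
      i ≠ o → d ≠ e → d ≠ o → d ≠ i →
      f (G.edge w d) + h i (G.edge w d) = f w + h i w := by
    obtain ⟨f, hf⟩ := exists_link_primitive (residue G e v₀) ⟨o, ho⟩ (hG e v₀).2.2 ⟨v₀, .refl⟩
      (fun i w => h i w.1) fun i j d w hio hjo hdo hdi hdj => hinv i j d w.1
        i.2 (fun h => hio (Subtype.ext h)) j.2 (fun h => hjo (Subtype.ext h)) d.2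
        (fun h => hdo (Subtype.ext h)) (fun h => hdi (Subtype.ext h)) fun h => hdj (Subtype.ext h)
    obtain ⟨F, hF⟩ : ∃ F : G.V → ZMod 2, ∀ w (hw : reaches G {e}ᶜ v₀ w), F w = f ⟨w, hw⟩ :=
      ⟨fun w => if hw : reaches G {e}ᶜ v₀ w then f ⟨w, hw⟩ else 0, fun w hw => dif_pos hw⟩
    refine ⟨F, fun w hw i d hie hio hde hdo hdi => ?_⟩
    obtain ⟨hw', hr⟩ := residue_reaches G ho hw
    have := hf ⟨w, hw'⟩ hr ⟨i, hie⟩ ⟨d, hde⟩ (fun h => hio (congrArg Subtype.val h))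
      (fun h => hdo (congrArg Subtype.val h)) (fun h => hdi (congrArg Subtype.val h))
    rw [hF _ hw', hF _ (reaches_edge G hw' hde)]
    exact this
  choose f hf using key
  refine ⟨fun w => f (Quot.mk (step G {e, o}ᶜ) w).out w, fun w i d hie hio hde hdo hdi => ?_⟩
  have hd : d ∈ ({e, o}ᶜ : Set (Fin 5)) := by simp [hde, hdo]
  have hq : Quot.mk (step G {e, o}ᶜ) (G.edge w d) = Quot.mk (step G {e, o}ᶜ) w :=
    (Quot.sound ⟨d, hd, rfl⟩).symm
  dsimp only
  rw [hq]
  exact hf _ w (reaches_of_quot_eq G (Quot.out_eq _)) i d hie hio hde hdo hdi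

/-- The `ℤ/2`-valued functions on the vertices that are constant on the components of the subgraph
with colors in `B`. -/
def invariants (G : CGraph C) (B : Set C) : Submodule (ZMod 2) (G.V → ZMod 2) where
  carrier := {u | ∀ v, ∀ c ∈ B, u (G.edge v c) = u v}
  zero_mem' _ _ _ := rfl
  add_mem' hu hw v c hc := congrArg₂ (· + ·) (hu v c hc) (hw v c hc)
  smul_mem' r _ hu v c hc := congrArg (r • ·) (hu v c hc)

theorem finrank_invariants (G : CGraph C) (B : Set C) :
    Module.finrank (ZMod 2) (invariants G B) = gB G B := by
  have := Fintype.ofFinite (Quot (step G B))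
  let e : (Quot (step G B) → ZMod 2) ≃ₗ[ZMod 2] invariants G B :=
    { toFun := fun u => ⟨fun v => u (Quot.mk _ v), fun v c hc =>
        congrArg u (Quot.sound ⟨c, hc, rfl⟩).symm⟩
      map_add' := fun _ _ => rfl
      map_smul' := fun _ _ => rfl
      invFun := fun u => Quot.lift u.1 fun v w ⟨c, hc, hw⟩ => hw ▸ (u.2 v c hc).symm
      left_inv := fun u => funext fun q => Quot.inductionOn q fun _ => rfl
      right_inv := fun _ => rfl }
  rw [← e.finrank_eq, Module.finrank_fintype_fun_eq_card, gB, Nat.card_eq_fintype_card]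

theorem invariants_inf (G : CGraph C) (B B' : Set C) :
    invariants G B ⊓ invariants G B' = invariants G (B ∪ B') := by
  ext u
  exact ⟨fun h v c hc => hc.elim (h.1 v c) (h.2 v c),
    fun h => ⟨fun v c hc => h v c (.inl hc), fun v c hc => h v c (.inr hc)⟩⟩

theorem invariants_anti (G : CGraph C) {B B' : Set C} (h : B ⊆ B') :
    invariants G B' ≤ invariants G B :=
  fun _ hu v c hc => hu v c (h hc)

theorem gB_univ {G : CGraph C} (hc : Connected G) : gB G Set.univ = 1 := by
  obtain ⟨v⟩ := hc.1
  refine Nat.card_eq_one_iff_exists.mpr ⟨Quot.mk _ v, fun q => Quot.inductionOn q fun w => ?_⟩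
  induction hc.2 v w with
  | refl => rfl
  | tail _ h ih => exact (Quot.sound h).symm.trans ih

theorem gB_add_gB_le {G : CGraph C} (hc : Connected G) {B B' : Set C} (h : B ∪ B' = Set.univ) :
    gB G B + gB G B' ≤ gB G (B ∩ B') + 1 := by
  rw [← gB_univ hc, ← h]
  simp only [← finrank_invariants]
  rw [← Submodule.finrank_sup_add_finrank_inf_eq, invariants_inf]
  gcongr
  exact Submodule.finrank_mono (sup_le (invariants_anti G Set.inter_subset_left)
    (invariants_anti G Set.inter_subset_right))

section Duality

variable (G : CGraph C) [Fintype G.V]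

/-- The standard bilinear form on `ℤ/2`-valued functions on the vertices. -/
noncomputable def dotForm : LinearMap.BilinForm (ZMod 2) (G.V → ZMod 2) :=
  dotProductBilin (ZMod 2) (ZMod 2)

theorem dotForm_apply (u w : G.V → ZMod 2) : dotForm G u w = u ⬝ᵥ w := rfl

theorem finrank_orthogonal_dotForm (W : Submodule (ZMod 2) (G.V → ZMod 2)) :
    Module.finrank (ZMod 2) ((dotForm G).orthogonal W) + Module.finrank (ZMod 2) W =
      Nat.card G.V := by
  have hr : (dotForm G).IsRefl := fun u w h => by
    rwa [dotForm_apply, dotProduct_comm]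
  have hn : (dotForm G).Nondegenerate := by
    refine (LinearMap.IsRefl.nondegenerate_iff_separatingLeft hr).mpr ?_
    exact fun u h => dotProduct_eq_zero u h
  have h := LinearMap.BilinForm.finrank_orthogonal hn W
  have := W.finrank_le
  rw [Module.finrank_fintype_fun_eq_card] at h this
  rw [Nat.card_eq_fintype_card]
  omega

theorem orthogonal_invariants_singleton (c : C) :
    (dotForm G).orthogonal (invariants G {c}) = invariants G {c} := by
  ext w
  rw [LinearMap.BilinForm.mem_orthogonal_iff]
  constructor
  · rintro h v d rfl
    have h0 := h (Pi.single v 1 + Pi.single (G.edge v d) 1) fun x c hc => by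
      obtain rfl : c = d := hc
      have h1 : G.edge x c = v ↔ x = G.edge v c :=
        ⟨fun h => by rw [← h, G.invol], fun h => by rw [h, G.invol]⟩
      have h2 : G.edge x c = G.edge v c ↔ x = v :=
        ⟨fun h => by rw [← G.invol x c, h, G.invol], fun h => by rw [h]⟩
      simp only [Pi.add_apply, Pi.single_apply, h1, h2]
      exact add_comm _ _
    rw [dotForm_apply, add_dotProduct, single_one_dotProduct,
      single_one_dotProduct] at h0
    exact (CharTwo.add_eq_zero.mp h0).symm
  · intro hw u hu
    refine Finset.sum_involution (fun v _ => G.edge v c) (fun v _ => ?_)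
      (fun v _ _ => G.no_loop v c) (fun v _ => Finset.mem_univ _) (fun v _ => G.invol v c)
    rw [hu v c rfl, hw v c rfl]
    exact CharTwo.add_self_eq_zero _

theorem orthogonal_dotForm_sup (W W' : Submodule (ZMod 2) (G.V → ZMod 2)) :
    (dotForm G).orthogonal (W ⊔ W') = (dotForm G).orthogonal W ⊓ (dotForm G).orthogonal W' := by
  ext u
  refine ⟨fun h => ⟨fun w hw => h w (Submodule.mem_sup_left hw),
    fun w hw => h w (Submodule.mem_sup_right hw)⟩, fun h w hw => ?_⟩
  obtain ⟨x, hx, y, hy, rfl⟩ := Submodule.mem_sup.mp hw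
  rw [LinearMap.BilinForm.add_left, h.1 x hx, h.2 y hy, add_zero]

end Duality

theorem two_mul_gB_singleton (G : CGraph C) (c : C) : 2 * gB G {c} = Nat.card G.V := by
  have := Fintype.ofFinite G.V
  have h := finrank_orthogonal_dotForm G (invariants G {c})
  rw [orthogonal_invariants_singleton, finrank_invariants] at h
  omega

theorem finrank_invariants_sup (G : CGraph C) (a b : C) :
    Module.finrank (ZMod 2) ↥(invariants G {a} ⊔ invariants G {b}) + gB G {a, b} =
      Nat.card G.V := by
  have := Fintype.ofFinite G.V
  rw [← finrank_orthogonal_dotForm G (invariants G {a} ⊔ invariants G {b}),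
    orthogonal_dotForm_sup, orthogonal_invariants_singleton, orthogonal_invariants_singleton,
    invariants_inf, finrank_invariants, Set.singleton_union, add_comm]

theorem finrank_invariants_sup_sup (G : CGraph C) (a b c : C) :
    Module.finrank (ZMod 2) ↥(invariants G {a} ⊔ (invariants G {b} ⊔ invariants G {c})) +
      gB G {a, b, c} = Nat.card G.V := by
  have := Fintype.ofFinite G.V
  rw [← finrank_orthogonal_dotForm G (invariants G {a} ⊔ (invariants G {b} ⊔ invariants G {c})),
    orthogonal_dotForm_sup, orthogonal_dotForm_sup, orthogonal_invariants_singleton,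
    orthogonal_invariants_singleton, orthogonal_invariants_singleton, invariants_inf,
    invariants_inf, finrank_invariants, Set.singleton_union, Set.singleton_union, add_comm]

/-- The subspaces of functions invariant under the colors `a`, `b` and `c` form a distributive
triple. -/
theorem IsSingularRep.invariants_inf_sup {G : CGraph (Fin 5)} (hG : IsSingularRep 4 G)
    {a b c : Fin 5} (hab : a ≠ b) (hac : a ≠ c) (hbc : b ≠ c) :
    invariants G {a} ⊓ (invariants G {b} ⊔ invariants G {c}) =
      invariants G {a, b} ⊔ invariants G {a, c} := by
  refine le_antisymm ?_ (sup_le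
    (le_inf (invariants_anti G (by simp)) (le_sup_of_le_left (invariants_anti G (by simp))))
    (le_inf (invariants_anti G (by simp)) (le_sup_of_le_right (invariants_anti G (by simp)))))
  rintro u ⟨hu, hbc'⟩
  obtain ⟨x, hx, y, hy, rfl⟩ := Submodule.mem_sup.mp hbc'
  obtain ⟨e, o, heo, hcompl⟩ : ∃ e o, e ≠ o ∧ ({a, b, c} : Finset (Fin 5))ᶜ = {e, o} := by
    rw [← Finset.card_eq_two, Finset.card_compl, Finset.card_eq_three.mpr
      ⟨a, b, c, hab, hac, hbc, rfl⟩, Fintype.card_fin]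
  have hmem (i : Fin 5) : (i ≠ e ∧ i ≠ o) ↔ (i = a ∨ i = b ∨ i = c) := by
    have := Finset.ext_iff.mp hcompl i
    simp only [Finset.mem_compl, Finset.mem_insert, Finset.mem_singleton] at this
    tauto
  obtain ⟨h, ha, hb, hc⟩ : ∃ h : Fin 5 → G.V → ZMod 2, h a = x + y ∧ h b = x ∧ h c = y :=
    ⟨fun i => if i = a then x + y else if i = b then x else y,
      by simp, by simp [hab.symm], by simp [hac.symm, hbc.symm]⟩
  obtain ⟨f, hf⟩ := hG.exists_primitive heo.symm h fun i j d v hie hio hje hjo hde hdo hdi hdj => by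
    have hi := (hmem i).mp ⟨hie, hio⟩
    have hj := (hmem j).mp ⟨hje, hjo⟩
    have hd := (hmem d).mp ⟨hde, hdo⟩
    have hxy : (x + y) (G.edge v a) = (x + y) v := hu v a rfl
    have hxb : x (G.edge v b) = x v := hx v b rfl
    have hyc : y (G.edge v c) = y v := hy v c rfl
    by_cases hij : i = j
    · rw [hij, CharTwo.add_self_eq_zero, CharTwo.add_self_eq_zero]
    have hxx := CharTwo.add_self_eq_zero (x v)
    have hyy := CharTwo.add_self_eq_zero (y v)
    have hxx' := CharTwo.add_self_eq_zero (x (G.edge v d))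
    have hyy' := CharTwo.add_self_eq_zero (y (G.edge v d))
    rcases hi with rfl | rfl | rfl <;> rcases hj with rfl | rfl | rfl <;>
      rcases hd with rfl | rfl | rfl <;> first
        | contradiction
        | (simp only [ha, hb, hc, Pi.add_apply] at *
           first
            | linear_combination hxy
            | linear_combination hxb + hyy' - hyy
            | linear_combination hyc + hxx' - hxx)
  have hinv (i p q : Fin 5) (hi : i = a ∨ i = b ∨ i = c) (hp : p = a ∨ p = b ∨ p = c)
      (hq : q = a ∨ q = b ∨ q = c) (hpi : p ≠ i) (hqi : q ≠ i) :
      f + h i ∈ invariants G {p, q} := by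
    rintro v d (rfl | rfl)
    exacts [hf v i _ ((hmem i).mpr hi).1 ((hmem i).mpr hi).2 ((hmem _).mpr hp).1
      ((hmem _).mpr hp).2 hpi, hf v i _ ((hmem i).mpr hi).1 ((hmem i).mpr hi).2
      ((hmem _).mpr hq).1 ((hmem _).mpr hq).2 hqi]
  have hsum : x + y = (f + h c) + (f + h b) := by
    ext v
    simp only [hb, hc, Pi.add_apply]
    linear_combination -CharTwo.add_self_eq_zero (f v)
  rw [hsum]
  exact Submodule.add_mem_sup (hinv c a b (by simp) (by simp) (by simp) hac hbc)
    (hinv b a c (by simp) (by simp) (by simp) hab hbc.symm)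

/-- The Euler characteristic of the `2`-sphere, for residues with three colors. -/
theorem IsSingularRep.gB_triple {G : CGraph (Fin 5)} (hG : IsSingularRep 4 G)
    {a b c : Fin 5} (hab : a ≠ b) (hac : a ≠ c) (hbc : b ≠ c) :
    2 * (gB G {a, b} + gB G {b, c} + gB G {a, c}) = Nat.card G.V + 4 * gB G {a, b, c} := by
  have h1 := Submodule.finrank_sup_add_finrank_inf_eq (invariants G {a})
    (invariants G {b} ⊔ invariants G {c})
  have h2 := Submodule.finrank_sup_add_finrank_inf_eq (invariants G {a, b}) (invariants G {a, c})
  have hU : ({a, b} ∪ {a, c} : Set (Fin 5)) = {a, b, c} := by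
    ext
    simp
    tauto
  rw [hG.invariants_inf_sup hab hac hbc, finrank_invariants] at h1
  rw [invariants_inf, hU, finrank_invariants, finrank_invariants, finrank_invariants] at h2
  have h3 := finrank_invariants_sup G b c
  have h4 := finrank_invariants_sup_sup G a b c
  have h5 := two_mul_gB_singleton G a
  omega

theorem rhoL_four (G : CGraph C) (a b c d : C) :
    rhoL G [a, b, c, d] = gB G {a, b, c, d} -
      (gB G {a, b} + gB G {b, c} + gB G {c, d} + gB G {d, a} - (Nat.card G.V : ℚ)) / 2 := by
  have h0 : pairSet [a, b, c, d] 0 = {a, b} := by ext; simp [pairSet, eq_comm]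
  have h1 : pairSet [a, b, c, d] 1 = {b, c} := by ext; simp [pairSet, eq_comm]
  have h2 : pairSet [a, b, c, d] 2 = {c, d} := by ext; simp [pairSet, eq_comm]
  have h3 : pairSet [a, b, c, d] 3 = {d, a} := by ext; simp [pairSet, eq_comm]
  have h : {x | x ∈ [a, b, c, d]} = ({a, b, c, d} : Set C) := by ext; simp
  simp only [rhoL, List.length_cons, List.length_nil, Finset.sum_range_succ, Finset.sum_range_zero,
    h0, h1, h2, h3, h]
  push_cast
  ring

theorem rhoL_five (G : CGraph C) (a b c d e : C) :
    rhoL G [a, b, c, d, e] = gB G {a, b, c, d, e} -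
      (gB G {a, b} + gB G {b, c} + gB G {c, d} + gB G {d, e} + gB G {e, a} -
        3 * (Nat.card G.V : ℚ) / 2) / 2 := by
  have h0 : pairSet [a, b, c, d, e] 0 = {a, b} := by ext; simp [pairSet, eq_comm]
  have h1 : pairSet [a, b, c, d, e] 1 = {b, c} := by ext; simp [pairSet, eq_comm]
  have h2 : pairSet [a, b, c, d, e] 2 = {c, d} := by ext; simp [pairSet, eq_comm]
  have h3 : pairSet [a, b, c, d, e] 3 = {d, e} := by ext; simp [pairSet, eq_comm]
  have h4 : pairSet [a, b, c, d, e] 4 = {e, a} := by ext; simp [pairSet, eq_comm]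
  have h : {x | x ∈ [a, b, c, d, e]} = ({a, b, c, d, e} : Set C) := by ext; simp
  simp only [rhoL, List.length_cons, List.length_nil, Finset.sum_range_succ, Finset.sum_range_zero,
    h0, h1, h2, h3, h4, h]
  push_cast
  ring

theorem permList_five (ε : Equiv.Perm (Fin 5)) : permList ε = [ε 0, ε 1, ε 2, ε 3, ε 4] := rfl

theorem rhoL_permList (G : CGraph (Fin 5)) (ε : Equiv.Perm (Fin 5)) :
    rhoL G (permList ε) = gB G Set.univ -
      (∑ j, (gB G {ε j, ε (j + 1)} : ℚ) - 3 * (Nat.card G.V : ℚ) / 2) / 2 := by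
  have h : ({ε 0, ε 1, ε 2, ε 3, ε 4} : Set (Fin 5)) = Set.univ := by
    refine Set.eq_univ_of_forall fun x => ?_
    obtain ⟨j, rfl⟩ := ε.surjective x
    fin_cases j <;> simp
  rw [permList_five, rhoL_five, h, Fin.sum_univ_five]
  rfl

theorem rhoL_permList_erase (G : CGraph (Fin 5)) (ε : Equiv.Perm (Fin 5)) (k : Fin 5) :
    rhoL G ((permList ε).erase (ε k)) = gB G {ε k}ᶜ -
      (gB G {ε (k + 1), ε (k + 2)} + gB G {ε (k + 2), ε (k + 3)} + gB G {ε (k + 3), ε (k + 4)} +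
        gB G {ε (k + 4), ε (k + 1)} - (Nat.card G.V : ℚ)) / 2 := by
  have hc (k a b c d : Fin 5) (h : ∀ j, (j = a ∨ j = b ∨ j = c ∨ j = d) ↔ j ≠ k) :
      ({ε a, ε b, ε c, ε d} : Set (Fin 5)) = {ε k}ᶜ := by
    ext x
    obtain ⟨j, rfl⟩ := ε.surjective x
    simpa using h j
  rw [permList_five]
  fin_cases k <;> simp [rhoL_four]
  · rw [hc 0 1 2 3 4 (by decide)]
  · rw [hc 1 0 2 3 4 (by decide)]
    ring
  · rw [hc 2 0 1 3 4 (by decide)]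
    ring
  · rw [hc 3 0 1 2 4 (by decide)]
    ring
  · rw [hc 4 0 1 2 3 (by decide)]

theorem sum_eq_shift (p : Fin 5 → ℚ) (k : Fin 5) :
    ∑ j, p j = p k + p (k + 1) + p (k + 2) + p (k + 3) + p (k + 4) := by
  rw [← Equiv.sum_comp (Equiv.addLeft k) p, Fin.sum_univ_five]
  simp

theorem IsSingularRep.gB_triple_skew {G : CGraph (Fin 5)} (hG : IsSingularRep 4 G)
    (ε : Equiv.Perm (Fin 5)) (k : Fin 5) :
    2 * (gB G {ε k, ε (k + 2)} + gB G {ε (k + 2), ε (k + 3)} + gB G {ε (k + 3), ε k}) =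
      Nat.card G.V + 4 * gB G {ε k, ε (k + 2), ε (k + 3)} := by
  rw [Set.pair_comm (ε (k + 3)) (ε k)]
  exact hG.gB_triple (ε.injective.ne (by simp)) (ε.injective.ne (by simp))
    (ε.injective.ne (by simp))

theorem IsSingularRep.rhoL_add_le {G : CGraph (Fin 5)} (hc : Connected G)
    (hG : IsSingularRep 4 G) (ε : Equiv.Perm (Fin 5)) (i : Fin 5) :
    rhoL G ((permList ε).erase (ε (i - 1))) + rhoL G ((permList ε).erase (ε (i + 1)))
      ≤ rhoL G (permList ε) := by
  have hi : i - 1 = i + 4 := by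
    revert i
    decide
  have hcompl : ({ε (i + 4)}ᶜ ∩ {ε (i + 1)}ᶜ : Set (Fin 5)) = {ε i, ε (i + 2), ε (i + 3)} := by
    ext x
    obtain ⟨j, rfl⟩ := ε.surjective x
    have : ∀ i j : Fin 5, (¬j = i + 4 ∧ ¬j = i + 1) ↔ (j = i ∨ j = i + 2 ∨ j = i + 3) := by decide
    simpa using this i j
  have hunion : ({ε (i + 4)}ᶜ ∪ {ε (i + 1)}ᶜ : Set (Fin 5)) = Set.univ := by
    rw [← Set.compl_inter, Set.singleton_inter_eq_empty.mpr (by simp), Set.compl_empty]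
  have h1 : (gB G {ε (i + 4)}ᶜ + gB G {ε (i + 1)}ᶜ : ℚ) ≤
      gB G {ε i, ε (i + 2), ε (i + 3)} + 1 := by
    rw [← hcompl]
    exact_mod_cast gB_add_gB_le hc hunion
  have h2 : (2 * (gB G {ε i, ε (i + 2)} + gB G {ε (i + 2), ε (i + 3)} + gB G {ε (i + 3), ε i}) :
      ℚ) = Nat.card G.V + 4 * gB G {ε i, ε (i + 2), ε (i + 3)} := by
    exact_mod_cast hG.gB_triple_skew ε i
  rw [hi, rhoL_permList_erase, rhoL_permList_erase, rhoL_permList, gB_univ hc, sum_eq_shift _ i]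
  simp only [add_assoc, Fin.reduceAdd, add_zero] at *
  push_cast
  linarith

theorem IsSingularRep.exists_int_rhoL {G : CGraph (Fin 5)} (hG : IsSingularRep 4 G)
    (ε : Equiv.Perm (Fin 5)) (k : Fin 5) :
    ∃ m : ℤ, rhoL G ((permList ε).erase (ε k)) = m := by
  refine ⟨gB G {ε k}ᶜ - gB G {ε (k + 1), ε (k + 2), ε (k + 3)} -
    gB G {ε (k + 1), ε (k + 3), ε (k + 4)} + gB G {ε (k + 1), ε (k + 3)}, ?_⟩
  have h1 : (2 * (gB G {ε (k + 1), ε (k + 2)} + gB G {ε (k + 2), ε (k + 3)} +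
      gB G {ε (k + 1), ε (k + 3)}) : ℚ) =
      Nat.card G.V + 4 * gB G {ε (k + 1), ε (k + 2), ε (k + 3)} := by
    exact_mod_cast hG.gB_triple (ε.injective.ne (by simp)) (ε.injective.ne (by simp))
      (ε.injective.ne (by simp))
  have h2 : (2 * (gB G {ε (k + 1), ε (k + 3)} + gB G {ε (k + 3), ε (k + 4)} +
      gB G {ε (k + 4), ε (k + 1)}) : ℚ) =
      Nat.card G.V + 4 * gB G {ε (k + 1), ε (k + 3), ε (k + 4)} := by
    have := hG.gB_triple_skew ε (k + 1)
    simp only [add_assoc k, Fin.reduceAdd] at this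
    exact_mod_cast this
  rw [rhoL_permList_erase]
  push_cast
  linarith

/-- for a connected 5-colored graph representing a singular 4-manifold and
a cyclic permutation `ε`, writing `ρ = ρ_ε(Γ)` and `ρ_î = ρ_ε(Γ_{ε̂_i})`:
`ρ_{î-1} + ρ_{î+1} ≤ ρ` for all `i`; consequently `Σ_i ρ_î ≤ ⌊(5/2) ρ⌋`, with
`Σ_i ρ_î = (5/2) ρ` if and only if `ρ_{î-1} + ρ_{î+1} = ρ` for all `i ∈ Δ₄`. -/
theorem subgenus_inequalities (G : CGraph (Fin 5)) (hc : Connected G)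
    (hG : IsSingularRep 4 G) (ε : Equiv.Perm (Fin 5)) :
    (∀ i : Fin 5,
      rhoL G ((permList ε).erase (ε (i - 1))) + rhoL G ((permList ε).erase (ε (i + 1)))
        ≤ rhoL G (permList ε)) ∧
    (∑ i : Fin 5, rhoL G ((permList ε).erase (ε i))
        ≤ (⌊(5 / 2 : ℚ) * rhoL G (permList ε)⌋ : ℚ)) ∧
    ((∑ i : Fin 5, rhoL G ((permList ε).erase (ε i)) = (5 / 2 : ℚ) * rhoL G (permList ε)) ↔
      ∀ i : Fin 5,
        rhoL G ((permList ε).erase (ε (i - 1))) + rhoL G ((permList ε).erase (ε (i + 1)))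
          = rhoL G (permList ε)) := by
  have hle := hG.rhoL_add_le hc ε
  have hsum : ∑ i, (rhoL G ((permList ε).erase (ε (i - 1))) +
      rhoL G ((permList ε).erase (ε (i + 1)))) = 2 * ∑ i, rhoL G ((permList ε).erase (ε i)) := by
    rw [Finset.sum_add_distrib, two_mul]
    exact congrArg₂ (· + ·)
      (Equiv.sum_comp (Equiv.subRight 1) fun i => rhoL G ((permList ε).erase (ε i)))
      (Equiv.sum_comp (Equiv.addRight 1) fun i => rhoL G ((permList ε).erase (ε i)))
  have hconst : ∑ _i : Fin 5, rhoL G (permList ε) = 5 * rhoL G (permList ε) := by simp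
  refine ⟨hle, ?_, ?_⟩
  · choose m hm using hG.exists_int_rhoL ε
    have h := Finset.sum_le_sum fun i (_ : i ∈ Finset.univ) => hle i
    rw [hsum, hconst] at h
    have hm' : ∑ i, rhoL G ((permList ε).erase (ε i)) = ((∑ i, m i : ℤ) : ℚ) := by
      push_cast
      exact Finset.sum_congr rfl fun i _ => hm i
    rw [hm'] at h ⊢
    exact_mod_cast Int.le_floor.mpr (by linarith)
  · have h := Finset.sum_eq_sum_iff_of_le fun i (_ : i ∈ Finset.univ) => hle i
    rw [hsum, hconst] at h
    simp only [Finset.mem_univ, forall_true_left] at h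
    rw [← h]
    constructor <;> intro h <;> linarith

end Cryst
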